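/- arXiv:1809.00382 — 2 statements merged into one kernel-verified Lean document; each statement's English description precedes it below -/
import Mathlib

section
/- Let p ≥ 3 be an integer, M_p > 0, and let f : ℝ^n → ℝ be convex with M_p-Lipschitz p-th derivative, and let x* be a global minimizer of f. Let sequences (x^k), (y^k), (u^k) in ℝ^n, positive reals (L_k) and reals (a_k), (A_k) satisfy: A_0 = 0, u^0 = y^0, and for every k ≥ 0: a_{k+1} = (1/L_k + sqrt(1/L_k^2 + 4 A_k/L_k))/2, A_{k+1} = A_k + a_{k+1}, x^k = (A_k/A_{k+1}) y^k + (a_{k+1}/A_{k+1}) u^k, y^{k+1} is a global minimizer over ℝ^n of the function y ↦ Ω_p(f, x^k; y) + (p M_p/(p+1)!) ∥y − x^k∥^{p+1} + (L_k/2) ∥y − x^k∥^2, the step-size condition 1/2 ≤ (2(p+1)M_p/(p! L_k)) ∥y^{k+1} − x^k∥^{p−1} ≤ 1 holds, and u^{k+1} = u^k − a_{k+1} ∇f(y^{k+1}). Then for every N ≥ 1, f(y^N) − f(x*) ≤ c M_p ∥y^0 − x*∥^{p+1} / N^{(3p+1)/2}, where c = 2^{(3(p+1)^2+4)/4} (p+1)/p!.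 -/
/-- The `p`-th order Taylor polynomial of `f` at `x`, evaluated at `y`:
`Ω_p(f, x; y) = ∑_{r=0}^p (1/r!) ∇^r f(x)[y-x, …, y-x]`. -/
noncomputable def taylorModel {n : ℕ} (p : ℕ) (f : EuclideanSpace ℝ (Fin n) → ℝ)
    (x y : EuclideanSpace ℝ (Fin n)) : ℝ :=
  ∑ r ∈ Finset.range (p + 1),
    (1 / (Nat.factorial r : ℝ)) * iteratedFDeriv ℝ r f x (fun _ => y - x)

/-- `f` is `p` times continuously differentiable with `M`-Lipschitz `p`-th derivative. -/
def HasLipschitzPthDeriv {n : ℕ} (p : ℕ) (M : ℝ) (f : EuclideanSpace ℝ (Fin n) → ℝ) : Prop :=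
  ContDiff ℝ p f ∧
    ∀ x y : EuclideanSpace ℝ (Fin n),
      ‖iteratedFDeriv ℝ p f x - iteratedFDeriv ℝ p f y‖ ≤ M * ‖x - y‖

section Taylor

open Set

variable {E : Type} [NormedAddCommGroup E] [NormedSpace ℝ E]

/-- The iterated derivative of a smooth function at a tuple which is constant except in one slot
does not depend on that slot. -/
theorem iteratedFDeriv_succ_update_const {F : Type} [NormedAddCommGroup F] [NormedSpace ℝ F]
    {f : E → F} {n : ℕ} (hf : ContDiff ℝ (n + 1 : ℕ) f) (x v h : E) (i : Fin (n + 1)) :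
    iteratedFDeriv ℝ (n + 1) f x (Function.update (fun _ => v) i h) =
      iteratedFDeriv ℝ n (fderiv ℝ f) x (fun _ => v) h := by
  induction n generalizing x with
  | zero =>
    obtain rfl : i = 0 := Fin.fin_one_eq_zero i
    simp
  | succ m ih =>
    have hf' : ContDiff ℝ (m + 1 : ℕ) f := hf.of_le (by exact_mod_cast Nat.le_succ _)
    have hfd : ContDiff ℝ (m + 1 : ℕ) (fderiv ℝ f) :=
      hf.fderiv_right (by norm_cast)
    have hd : Differentiable ℝ (iteratedFDeriv ℝ (m + 1) f) :=
      hf.differentiable_iteratedFDeriv (by norm_cast; omega)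
    have hdf : Differentiable ℝ (iteratedFDeriv ℝ m (fderiv ℝ f)) :=
      hfd.differentiable_iteratedFDeriv (by norm_cast; omega)
    have key : ∀ j : Fin (m + 1),
        iteratedFDeriv ℝ (m + 1 + 1) f x (Function.update (fun _ => v) j.succ h) =
          iteratedFDeriv ℝ (m + 1) (fderiv ℝ f) x (fun _ => v) h := by
      intro j
      have hup : Function.update (fun _ : Fin (m + 1 + 1) => v) j.succ h =
          Fin.cons v (Function.update (fun _ : Fin (m + 1) => v) j h) := by
        rw [Fin.cons_update]
        congr 1
        ext k
        refine Fin.cases ?_ (fun k => ?_) k <;> simp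
      rw [hup, iteratedFDeriv_succ_apply_left, iteratedFDeriv_succ_apply_left]
      simp only [Fin.cons_zero, Fin.tail_cons]
      have h1 : (fderiv ℝ (iteratedFDeriv ℝ (m + 1) f) x v)
          (Function.update (fun _ : Fin (m + 1) => v) j h) =
          fderiv ℝ (fun z => iteratedFDeriv ℝ (m + 1) f z
            (Function.update (fun _ : Fin (m + 1) => v) j h)) x v := by
        rw [fderiv_continuousMultilinear_apply_const_apply (hd x)]
      have h2 : (fderiv ℝ (iteratedFDeriv ℝ m (fderiv ℝ f)) x v) (Fin.tail fun _ => v) h =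
          fderiv ℝ (fun z => iteratedFDeriv ℝ m (fderiv ℝ f) z (fun _ => v) h) x v := by
        rw [fderiv_clm_apply ((hdf x).continuousMultilinear_apply_const _)
          (differentiableAt_const _)]
        simp [fderiv_continuousMultilinear_apply_const_apply (hdf x)]
        rfl
      rw [h1, h2]
      congr 2
      ext z
      exact ih hf' z j
    refine Fin.cases ?_ key i
    rw [← key 0]
    have hC2 : ContDiff ℝ 2 (iteratedFDeriv ℝ m f) :=
      hf.iteratedFDeriv_right (by norm_cast; omega)
    have hsymm : IsSymmSndFDerivAt ℝ (iteratedFDeriv ℝ m f) x :=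
      hC2.contDiffAt.isSymmSndFDerivAt (by simp)
    have hdm : Differentiable ℝ (fderiv ℝ (iteratedFDeriv ℝ m f)) :=
      (hC2.fderiv_right (m := 1) (by norm_num)).differentiable (by norm_num)
    have expand : ∀ a b : E, iteratedFDeriv ℝ (m + 1 + 1) f x
        (Fin.cons a (Fin.cons b fun _ : Fin m => v)) =
        fderiv ℝ (fderiv ℝ (iteratedFDeriv ℝ m f)) x a b fun _ => v := by
      intro a b
      rw [iteratedFDeriv_succ_apply_left]
      simp only [Fin.cons_zero, Fin.tail_cons]
      rw [← fderiv_continuousMultilinear_apply_const_apply (hd x)]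
      have : (fun z => iteratedFDeriv ℝ (m + 1) f z (Fin.cons b fun _ : Fin m => v)) =
          fun z => fderiv ℝ (iteratedFDeriv ℝ m f) z b fun _ => v := by
        ext z
        rw [iteratedFDeriv_succ_apply_left]
        simp
      rw [this, fderiv_continuousMultilinear_apply_const_apply
        ((hdm x).clm_apply (differentiableAt_const _)),
        fderiv_clm_apply (hdm x) (differentiableAt_const _)]
      simp
    have e0 : Function.update (fun _ : Fin (m + 1 + 1) => v) 0 h =
        Fin.cons h (Fin.cons v fun _ : Fin m => v) := by
      ext k
      refine Fin.cases ?_ (fun k => ?_) k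
      · simp
      · refine Fin.cases ?_ (fun k => ?_) k <;> simp
    have e1 : Function.update (fun _ : Fin (m + 1 + 1) => v) (Fin.succ 0) h =
        Fin.cons v (Fin.cons h fun _ : Fin m => v) := by
      ext k
      refine Fin.cases ?_ (fun k => ?_) k
      · simp
      · refine Fin.cases ?_ (fun k => ?_) k
        · simp
        · rw [Function.update_of_ne (by simp [Fin.ext_iff])]
          simp
    rw [e0, e1, expand, expand, hsymm.eq]

/-- Taylor's theorem for a function whose `q`-th derivative is Lipschitz. -/
theorem norm_sub_sum_iteratedFDeriv_le {M : ℝ} {q : ℕ} {G : Type} [NormedAddCommGroup G]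
    [NormedSpace ℝ G] {g : E → G} (hg : ContDiff ℝ q g)
    (hM : ∀ x y, ‖iteratedFDeriv ℝ q g x - iteratedFDeriv ℝ q g y‖ ≤ M * ‖x - y‖) (x v : E) :
    ‖g (x + v) - ∑ j ∈ Finset.range (q + 1),
      (1 / (j.factorial : ℝ)) • iteratedFDeriv ℝ j g x (fun _ => v)‖ ≤
      M * ‖v‖ ^ (q + 1) / (q + 1).factorial := by
  induction q generalizing G v with
  | zero =>
    have h := hM (x + v) x
    rw [iteratedFDeriv_zero_eq_comp] at h
    simp only [Function.comp_apply, ← map_sub, LinearIsometryEquiv.norm_map] at h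
    simpa using h
  | succ q ih =>
    have hgd : ContDiff ℝ q (fderiv ℝ g) := hg.fderiv_right (by norm_cast)
    have hdiff : Differentiable ℝ g := hg.differentiable (by norm_cast)
    have hM' : ∀ x y, ‖iteratedFDeriv ℝ q (fderiv ℝ g) x - iteratedFDeriv ℝ q (fderiv ℝ g) y‖ ≤
        M * ‖x - y‖ := by
      intro x y
      have h := hM x y
      rw [iteratedFDeriv_succ_eq_comp_right, iteratedFDeriv_succ_eq_comp_right,
        Function.comp_apply, Function.comp_apply, ← LinearIsometryEquiv.map_sub,
        LinearIsometryEquiv.norm_map] at h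
      exact h
    let φ : ℝ → G := fun t => g (x + t • v) - ∑ j ∈ Finset.range (q + 1 + 1),
      (t ^ j / (j.factorial : ℝ)) • iteratedFDeriv ℝ j g x (fun _ => v)
    let φ' : ℝ → G := fun t => (fderiv ℝ g (x + t • v) - ∑ j ∈ Finset.range (q + 1),
      (1 / (j.factorial : ℝ)) • iteratedFDeriv ℝ j (fderiv ℝ g) x (fun _ => t • v)) v
    have hφ : ∀ t, HasDerivAt φ (φ' t) t := by
      intro t
      have h1 : HasDerivAt (fun s : ℝ => g (x + s • v)) (fderiv ℝ g (x + t • v) v) t := by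
        have hl : HasDerivAt (fun s : ℝ => x + s • v) v t := by
          simpa using ((hasDerivAt_id t).smul_const v).const_add x
        exact (hdiff (x + t • v)).hasFDerivAt.comp_hasDerivAt t hl
      have h2 : HasDerivAt (fun s : ℝ => ∑ j ∈ Finset.range (q + 1 + 1),
          (s ^ j / (j.factorial : ℝ)) • iteratedFDeriv ℝ j g x (fun _ => v))
          (∑ j ∈ Finset.range (q + 1 + 1),
          ((j : ℝ) * t ^ (j - 1) / (j.factorial : ℝ)) • iteratedFDeriv ℝ j g x (fun _ => v)) t :=
        HasDerivAt.fun_sum fun j _ => ((hasDerivAt_pow j t).div_const _).smul_const _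
      refine (h1.sub h2).congr_deriv ?_
      simp only [φ', sub_apply, sum_apply]
      congr 1
      rw [Finset.sum_range_succ']
      simp only [Nat.cast_zero, zero_mul, zero_div, zero_smul, add_zero]
      refine Finset.sum_congr rfl fun j _ => ?_
      have h3 : iteratedFDeriv ℝ (j + 1) g x (fun _ => v) =
          iteratedFDeriv ℝ j (fderiv ℝ g) x (fun _ => v) v := by
        rw [iteratedFDeriv_succ_apply_right]; rfl
      have h4 : iteratedFDeriv ℝ j (fderiv ℝ g) x (fun _ => t • v) =
          t ^ j • iteratedFDeriv ℝ j (fderiv ℝ g) x (fun _ => v) := by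
        have := (iteratedFDeriv ℝ j (fderiv ℝ g) x).map_smul_univ (fun _ => t) (fun _ => v)
        simpa using this
      rw [h3, h4, smul_apply, smul_apply, smul_smul]
      congr 1
      rw [Nat.factorial_succ]
      push_cast
      have : (j.factorial : ℝ) ≠ 0 := by positivity
      field_simp
    have hB : ∀ t : ℝ, HasDerivAt
        (fun t : ℝ => M * ‖v‖ ^ (q + 1 + 1) / (q + 1 + 1).factorial * t ^ (q + 1 + 1))
        (M * ‖v‖ ^ (q + 1 + 1) / (q + 1).factorial * t ^ (q + 1)) t := by
      intro t
      refine ((hasDerivAt_pow (q + 1 + 1) t).const_mul _).congr_deriv ?_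
      rw [Nat.factorial_succ (q + 1)]
      push_cast
      have : ((q + 1).factorial : ℝ) ≠ 0 := by positivity
      field_simp
    have hbound : ∀ t ∈ Ico (0 : ℝ) 1,
        ‖φ' t‖ ≤ M * ‖v‖ ^ (q + 1 + 1) / (q + 1).factorial * t ^ (q + 1) := by
      intro t ht
      refine (ContinuousLinearMap.le_opNorm _ _).trans ?_
      refine (mul_le_mul_of_nonneg_right (ih hgd hM' (t • v)) (norm_nonneg v)).trans_eq ?_
      rw [norm_smul, Real.norm_of_nonneg ht.1]
      ring
    have hφ0 : ‖φ 0‖ ≤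
        M * ‖v‖ ^ (q + 1 + 1) / (q + 1 + 1).factorial * (0 : ℝ) ^ (q + 1 + 1) := by
      simp [φ, Finset.sum_range_succ']
    have := image_norm_le_of_norm_deriv_right_le_deriv_boundary (a := 0) (b := 1)
      (fun t _ => (hφ t).continuousAt.continuousWithinAt)
      (fun t _ => (hφ t).hasDerivWithinAt) hφ0 hB hbound (right_mem_Icc.2 zero_le_one)
    simpa [φ] using this

end Taylor

section Step

open Finset

variable {n : ℕ}

theorem hasFDerivAt_taylorModel {p : ℕ} {f : EuclideanSpace ℝ (Fin n) → ℝ}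
    (hf : ContDiff ℝ (p + 1 : ℕ) f) (x y : EuclideanSpace ℝ (Fin n)) :
    HasFDerivAt (taylorModel (p + 1) f x)
      (∑ j ∈ range (p + 1), (1 / (j.factorial : ℝ)) •
        iteratedFDeriv ℝ j (fderiv ℝ f) x (fun _ => y - x)) y := by
  have hterm : ∀ j ∈ range (p + 1), HasFDerivAt
      (fun z => 1 / ((j + 1).factorial : ℝ) * iteratedFDeriv ℝ (j + 1) f x (fun _ => z - x))
      ((1 / (j.factorial : ℝ)) • iteratedFDeriv ℝ j (fderiv ℝ f) x (fun _ => y - x)) y := by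
    intro j hj
    have hd : HasFDerivAt (fun (z : EuclideanSpace ℝ (Fin n)) (_ : Fin (j + 1)) => z - x)
        (ContinuousLinearMap.pi fun _ => ContinuousLinearMap.id ℝ _) y :=
      hasFDerivAt_pi.2 fun _ => (hasFDerivAt_id y).sub_const x
    have h := (((iteratedFDeriv ℝ (j + 1) f x).hasFDerivAt (fun _ => y - x)).comp y hd).const_mul
      (1 / ((j + 1).factorial : ℝ))
    refine h.congr_fderiv ?_
    ext w
    have hfj : ContDiff ℝ (j + 1 : ℕ) f :=
      hf.of_le (by have := mem_range.1 hj; exact_mod_cast this)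
    simp only [smul_apply, ContinuousLinearMap.comp_apply,
      ContinuousMultilinearMap.linearDeriv_apply, ContinuousLinearMap.pi_apply,
      ContinuousLinearMap.id_apply, iteratedFDeriv_succ_update_const hfj, sum_const, card_univ,
      Fintype.card_fin, nsmul_eq_mul, smul_eq_mul, Nat.factorial_succ]
    have : (j.factorial : ℝ) ≠ 0 := by positivity
    push_cast
    field_simp
  have h := (HasFDerivAt.fun_sum hterm).add_const
    (1 / (Nat.factorial 0 : ℝ) * iteratedFDeriv ℝ 0 f x (fun _ => y - x))
  refine h.congr_of_eventuallyEq (Filter.Eventually.of_forall fun z => ?_)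
  simp [taylorModel, Finset.sum_range_succ']

/-- A minimizer `y` of the regularized Taylor model is an approximate proximal point. -/
theorem norm_gradient_add_smul_le {p : ℕ} (hp : 1 ≤ p) {M L : ℝ} (hM : 0 < M)
    {f : EuclideanSpace ℝ (Fin n) → ℝ} (hlip : HasLipschitzPthDeriv p M f)
    {x y : EuclideanSpace ℝ (Fin n)}
    (hy : IsMinOn (fun z => taylorModel p f x z
        + ((p : ℝ) * M / ((p + 1).factorial : ℝ)) * ‖z - x‖ ^ (p + 1)
        + (L / 2) * ‖z - x‖ ^ 2) Set.univ y) :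
    ‖gradient f y + L • (y - x)‖ ≤ (p + 1) * M / p.factorial * ‖y - x‖ ^ p := by
  obtain ⟨q, rfl⟩ : ∃ q, p = q + 1 := ⟨p - 1, by omega⟩
  obtain ⟨hC, hLip⟩ := hlip
  set D := ∑ j ∈ range (q + 1), (1 / (j.factorial : ℝ)) •
    iteratedFDeriv ℝ j (fderiv ℝ f) x (fun _ => y - x) with hD
  have htaylor : ‖fderiv ℝ f y - D‖ ≤ M * ‖y - x‖ ^ (q + 1) / (q + 1).factorial := by
    have h := norm_sub_sum_iteratedFDeriv_le (M := M) (q := q) (g := fderiv ℝ f)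
      (hC.fderiv_right (by norm_cast)) ?_ x (y - x)
    · rwa [add_sub_cancel] at h
    · intro a b
      have h := hLip a b
      rw [iteratedFDeriv_succ_eq_comp_right, iteratedFDeriv_succ_eq_comp_right,
        Function.comp_apply, Function.comp_apply, ← LinearIsometryEquiv.map_sub,
        LinearIsometryEquiv.norm_map] at h
      exact h
  have hsub : HasFDerivAt (fun z => z - x) (ContinuousLinearMap.id ℝ _) y :=
    (hasFDerivAt_id y).sub_const x
  have hpow : HasFDerivAt (fun z => ‖z - x‖ ^ (q + 1 + 1))
      ((((q : ℝ) + 2) * ‖y - x‖ ^ q) • innerSL ℝ (y - x)) y := by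
    have h := (hasFDerivAt_norm_rpow (y - x) (p := (q : ℝ) + 2)
      (by linarith [q.cast_nonneg (α := ℝ)])).comp y hsub
    refine (h.congr_fderiv ?_).congr_of_eventuallyEq (Filter.Eventually.of_forall fun z => ?_)
    · rw [add_sub_cancel_right, Real.rpow_natCast]
      rfl
    · simp only [Function.comp_apply]
      rw [← Real.rpow_natCast]
      push_cast
      ring_nf
  have hsq : HasFDerivAt (fun z => ‖z - x‖ ^ 2) ((2 : ℝ) • innerSL ℝ (y - x)) y := by
    refine hsub.norm_sq.congr_fderiv ?_
    ext w
    simp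
  have hstat := hy.isLocalMin Filter.univ_mem |>.hasFDerivAt_eq_zero
    (((hasFDerivAt_taylorModel hC x y).add (hpow.const_mul _)).add (hsq.const_mul (L / 2)))
  set β : ℝ := ((q : ℝ) + 1) * M / (q + 1).factorial * ‖y - x‖ ^ q with hβ
  have hDw : ∀ w, D w + (β + L) * inner ℝ (y - x) w = 0 := by
    intro w
    have h := congrArg (fun T => T w) hstat
    simp only [add_apply, smul_apply, innerSL_apply_apply, smul_eq_mul, zero_apply] at h
    rw [← h, hβ, hD, Nat.factorial_succ (q + 1)]
    have : ((q + 1).factorial : ℝ) ≠ 0 := by positivity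
    push_cast
    field_simp
    ring
  have hgrad : ‖gradient f y + (β + L) • (y - x)‖ ≤
      M * ‖y - x‖ ^ (q + 1) / (q + 1).factorial := by
    set w := gradient f y + (β + L) • (y - x) with hw
    have h1 : ‖w‖ ^ 2 = (fderiv ℝ f y - D) w := by
      rw [← real_inner_self_eq_norm_sq]
      nth_rewrite 1 [hw]
      rw [inner_add_left, real_inner_smul_left, sub_apply, gradient,
        InnerProductSpace.toDual_symm_apply]
      linarith [hDw w]
    have h2 : ‖w‖ ^ 2 ≤ ‖fderiv ℝ f y - D‖ * ‖w‖ := by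
      rw [h1]
      exact (le_abs_self _).trans ((fderiv ℝ f y - D).le_opNorm w)
    refine le_trans ?_ htaylor
    by_contra! hlt
    nlinarith [norm_nonneg (fderiv ℝ f y - D), norm_nonneg w]
  have hβ0 : 0 ≤ β := by positivity
  calc ‖gradient f y + L • (y - x)‖
      = ‖(gradient f y + (β + L) • (y - x)) - β • (y - x)‖ := by
        congr 1
        module
    _ ≤ ‖gradient f y + (β + L) • (y - x)‖ + ‖β • (y - x)‖ := norm_sub_le _ _
    _ ≤ M * ‖y - x‖ ^ (q + 1) / (q + 1).factorial + β * ‖y - x‖ := by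
        rw [norm_smul, Real.norm_of_nonneg hβ0]
        gcongr
    _ = _ := by
        rw [hβ]
        push_cast
        ring

/-- First-order lower bound for a differentiable convex function. -/
theorem ConvexOn.add_inner_gradient_le {F : Type*} [NormedAddCommGroup F] [InnerProductSpace ℝ F]
    [CompleteSpace F] {f : F → ℝ} (hf : ConvexOn ℝ Set.univ f) {y : F}
    (hd : DifferentiableAt ℝ f y) (z : F) :
    f y + inner ℝ (gradient f y) (z - y) ≤ f z := by
  have hline : HasDerivAt (fun t : ℝ => AffineMap.lineMap y z t) (z - y) 0 :=
    AffineMap.hasDerivAt_lineMap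
  have hderiv : HasDerivAt (f ∘ fun t : ℝ => AffineMap.lineMap y z t)
      (fderiv ℝ f y (z - y)) 0 := by
    refine HasFDerivAt.comp_hasDerivAt (0 : ℝ) ?_ hline
    simpa using hd.hasFDerivAt
  have h := (hf.comp_affineMap (AffineMap.lineMap y z)).le_slope_of_hasDerivAt
    (Set.mem_univ 0) (Set.mem_univ 1) one_pos hderiv
  simp [slope_def_field] at h
  rw [gradient, InnerProductSpace.toDual_symm_apply]
  simp
  linarith

/-- One step of the accelerated hybrid proximal extragradient method decreases the potential
`A (f y - f x⋆) + ‖u - x⋆‖² / 2` by at least `3/8 A' L ‖y' - x‖²`. -/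
theorem potential_decrease {F : Type*} [NormedAddCommGroup F] [InnerProductSpace ℝ F]
    {fy fy' fs A a A' L : ℝ} {x y y' u u' s g : F} (hA : 0 ≤ A) (ha : 0 ≤ a)
    (hA' : 0 < A') (hsum : A' = A + a) (hquad : a ^ 2 * L = A')
    (hx : x = (A / A') • y + (a / A') • u) (hu : u' = u - a • g)
    (hfy : fy' + inner ℝ g (y - y') ≤ fy) (hfs : fy' + inner ℝ g (s - y') ≤ fs)
    (hg : ‖g + L • (y' - x)‖ ≤ L / 2 * ‖y' - x‖) :
    A' * (fy' - fs) + ‖u' - s‖ ^ 2 / 2 + 3 / 8 * (A' * L * ‖y' - x‖ ^ 2) ≤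
      A * (fy - fs) + ‖u - s‖ ^ 2 / 2 := by
  have hA'x : A' • x = A • y + a • u := by
    rw [hx, smul_add, smul_smul, smul_smul, mul_div_cancel₀ _ hA'.ne', mul_div_cancel₀ _ hA'.ne']
  have hin : A' * inner ℝ g x = A * inner ℝ g y + a * inner ℝ g u := by
    rw [← real_inner_smul_right, hA'x, inner_add_right, real_inner_smul_right,
      real_inner_smul_right]
  have hu' : ‖u' - s‖ ^ 2 =
      ‖u - s‖ ^ 2 - 2 * a * (inner ℝ g u - inner ℝ g s) + a ^ 2 * ‖g‖ ^ 2 := by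
    have : u' - s = (u - s) - a • g := by rw [hu]; abel
    rw [this, norm_sub_sq_real, real_inner_smul_right, real_inner_comm, inner_sub_right,
      norm_smul, mul_pow, Real.norm_eq_abs, sq_abs]
    ring
  have hg2 : ‖g‖ ^ 2 + 2 * L * (inner ℝ g y' - inner ℝ g x)
      + 3 / 4 * L ^ 2 * ‖y' - x‖ ^ 2 ≤ 0 := by
    have h := pow_le_pow_left₀ (norm_nonneg _) hg 2
    rw [norm_add_sq_real, real_inner_smul_right, inner_sub_right, norm_smul, mul_pow,
      Real.norm_eq_abs, sq_abs] at h
    nlinarith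
  rw [inner_sub_right] at hfy hfs
  have e1 := mul_le_mul_of_nonneg_left hfy hA
  have e2 := mul_le_mul_of_nonneg_left hfs ha
  have e3 := mul_le_mul_of_nonneg_left hg2 (by positivity : 0 ≤ a ^ 2 / 2)
  have e4 : a ^ 2 / 2 * (‖g‖ ^ 2 + 2 * L * (inner ℝ g y' - inner ℝ g x)
      + 3 / 4 * L ^ 2 * ‖y' - x‖ ^ 2) = a ^ 2 * ‖g‖ ^ 2 / 2
      + A' * (inner ℝ g y' - inner ℝ g x) + 3 / 8 * (A' * L * ‖y' - x‖ ^ 2) := by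
    rw [← hquad]; ring
  have e5 : A' * inner ℝ g y' = A * inner ℝ g y' + a * inner ℝ g y' := by rw [hsum]; ring
  have e6 : A' * (fy' - fs) = A * fy' + a * fy' - A * fs - a * fs := by rw [hsum]; ring
  linarith

end Step

section Growth

open Finset

/-- Lower bound for the growth of the `(p + 1)`-th root of `A` in one step. -/
theorem rpow_add_le_rpow_of_step {p : ℕ} (hp : 1 ≤ p) {A A' a L r θ : ℝ} (hA : 0 ≤ A) (ha : 0 < a)
    (hL : 0 < L) (hr : 0 < r) (hθ : 0 < θ) (hsum : A' = A + a) (hquad : a ^ 2 * L = A')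
    (hstep : θ * L ≤ r ^ (p - 1)) :
    A ^ (1 / ((p : ℝ) + 1)) + 1 / ((p : ℝ) + 1) * θ ^ (1 / ((p : ℝ) + 1)) *
      (A' * L * r ^ 2) ^ (-(((p : ℝ) - 1) / (2 * (p + 1)))) ≤ A' ^ (1 / ((p : ℝ) + 1)) := by
  set η : ℝ := 1 / ((p : ℝ) + 1) with hη
  have hp0 : (0 : ℝ) ≤ p := p.cast_nonneg
  have hη0 : 0 < η := by positivity
  have hη1 : η ≤ 1 := by rw [hη, div_le_one (by positivity)]; linarith
  have hA' : 0 < A' := by linarith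
  have hσ : -(((p : ℝ) - 1) / (2 * (p + 1))) = η - 1 / 2 := by rw [hη]; field_simp; ring
  rw [hσ]
  have hbern : A ^ η ≤ A' ^ η - η * (A' ^ η * (a / A')) := by
    have h := rpow_one_add_le_one_add_mul_self (s := -(a / A'))
      (by rw [neg_le_neg_iff, div_le_one hA']; linarith) hη0.le hη1
    have hAeq : A = A' * (1 + -(a / A')) := by field_simp; linarith
    rw [hAeq, Real.mul_rpow hA'.le (by rw [← sub_eq_add_neg, sub_nonneg, div_le_one hA']; linarith)]
    calc A' ^ η * (1 + -(a / A')) ^ η ≤ A' ^ η * (1 + η * -(a / A')) := by gcongr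
      _ = _ := by ring
  have ha_eq : a = A' ^ (1 / 2 : ℝ) * L ^ (-(1 / 2) : ℝ) := by
    rw [Real.rpow_neg hL.le, ← Real.sqrt_eq_rpow, ← Real.sqrt_eq_rpow, ← div_eq_mul_inv,
      ← Real.sqrt_div hA'.le, ← hquad, mul_div_cancel_right₀ _ hL.ne', Real.sqrt_sq ha.le]
  have hmain : θ ^ η * (A' * L * r ^ 2) ^ (η - 1 / 2) ≤ A' ^ η * (a / A') := by
    have e1 : (r ^ 2) ^ (η - 1 / 2) = (r ^ (p - 1)) ^ (-η) := by
      rw [← Real.rpow_natCast, ← Real.rpow_natCast, ← Real.rpow_mul hr.le, ← Real.rpow_mul hr.le,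
        Nat.cast_sub hp, hη]
      congr 1
      push_cast
      field_simp
      ring
    have e2 : A' ^ η * (a / A') = A' ^ (η - 1 / 2) * L ^ (-(1 / 2) : ℝ) := by
      rw [ha_eq, show η - 1 / 2 = η + (1 / 2 + -1) by ring, Real.rpow_add hA', Real.rpow_add hA',
        Real.rpow_neg_one]
      ring
    have e3 : L ^ (η - 1 / 2) = L ^ η * L ^ (-(1 / 2) : ℝ) := by
      rw [← Real.rpow_add hL]; ring_nf
    rw [e2, Real.mul_rpow (by positivity) (by positivity), Real.mul_rpow hA'.le hL.le, e1, e3]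
    have h1 : (θ * L) ^ η * (r ^ (p - 1)) ^ (-η) ≤ 1 := by
      rw [Real.rpow_neg (by positivity), ← div_eq_mul_inv, div_le_one (by positivity)]
      exact Real.rpow_le_rpow (by positivity) hstep hη0.le
    rw [Real.mul_rpow hθ.le hL.le] at h1
    calc θ ^ η * (A' ^ (η - 1 / 2) * (L ^ η * L ^ (-(1 / 2) : ℝ)) * (r ^ (p - 1)) ^ (-η))
        = (A' ^ (η - 1 / 2) * L ^ (-(1 / 2) : ℝ)) * (θ ^ η * L ^ η * (r ^ (p - 1)) ^ (-η)) := by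
          ring
      _ ≤ (A' ^ (η - 1 / 2) * L ^ (-(1 / 2) : ℝ)) * 1 := by gcongr
      _ = _ := mul_one _
  have := mul_le_mul_of_nonneg_left hmain hη0.le
  linarith

/-- Jensen's inequality for negative powers. -/
theorem card_mul_rpow_neg_le_sum_rpow_neg {N : ℕ} (hN : 1 ≤ N) {v : ℕ → ℝ} (hv : ∀ k, 0 < v k)
    {V σ : ℝ} (hσ : 0 ≤ σ) (hV : ∑ k ∈ range N, v k ≤ V) :
    N * (V / N) ^ (-σ) ≤ ∑ k ∈ range N, v k ^ (-σ) := by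
  have hN0 : (0 : ℝ) < N := by exact_mod_cast hN
  have hV0 : 0 < V :=
    (sum_pos (fun k _ => hv k) (nonempty_range_iff.2 (by omega))).trans_le hV
  set m := V / N with hm
  have hm0 : 0 < m := by positivity
  have hterm : ∀ k, m ^ (-σ) * (1 - σ * (v k / m - 1)) ≤ v k ^ (-σ) := by
    intro k
    have hq : 0 < v k / m := div_pos (hv k) hm0
    have h1 : v k ^ (-σ) = m ^ (-σ) * (v k / m) ^ (-σ) := by
      rw [← Real.mul_rpow hm0.le hq.le, mul_div_cancel₀ _ hm0.ne']
    rw [h1]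
    gcongr
    rw [Real.rpow_def_of_pos hq]
    have h2 := Real.add_one_le_exp (Real.log (v k / m) * -σ)
    have h3 := mul_le_mul_of_nonneg_right (Real.log_le_sub_one_of_pos hq) hσ
    linarith
  have hsum : ∑ k ∈ range N, m ^ (-σ) * (1 - σ * (v k / m - 1)) =
      m ^ (-σ) * (N - σ * ((∑ k ∈ range N, v k) / m - N)) := by
    rw [← mul_sum, sum_sub_distrib, ← mul_sum, sum_sub_distrib, sum_div]
    simp
  have hle : (∑ k ∈ range N, v k) / m ≤ N := by
    rw [div_le_iff₀ hm0, hm, mul_div_cancel₀ _ hN0.ne']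
    exact hV
  calc N * m ^ (-σ) ≤ m ^ (-σ) * (N - σ * ((∑ k ∈ range N, v k) / m - N)) := by
        rw [mul_comm]
        gcongr
        nlinarith
    _ ≤ _ := hsum ▸ sum_le_sum fun k _ => hterm k

/-- Numerical comparison of the constants in the convergence rate. -/
theorem two_mul_rpow_le_two_rpow {p : ℕ} (hp : 3 ≤ p) :
    2 * ((p : ℝ) + 1) ^ (p + 1) * 2 ^ (((p : ℝ) - 1) / 2) ≤
      2 ^ ((3 * ((p : ℝ) + 1) ^ 2 + 4) / 4) := by
  have hp' : (3 : ℝ) ≤ p := by exact_mod_cast hp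
  have hsq : (p + 1) ^ 2 ≤ 2 ^ (p + 1) := by
    clear hp'
    induction p, hp using Nat.le_induction with
    | base => norm_num
    | succ k hk ih =>
      rw [pow_succ 2 (k + 1)]
      nlinarith
  have hm : ((p : ℝ) + 1) ≤ 2 ^ (((p : ℝ) + 1) / 2) := by
    have h : ((p : ℝ) + 1) ^ 2 ≤ (2 ^ (((p : ℝ) + 1) / 2)) ^ 2 := by
      rw [← Real.rpow_natCast (2 ^ (((p : ℝ) + 1) / 2)), ← Real.rpow_mul (by norm_num)]
      have : ((p : ℝ) + 1) / 2 * ((2 : ℕ) : ℝ) = ((p + 1 : ℕ) : ℝ) := by push_cast; ring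
      rw [this, Real.rpow_natCast]
      exact_mod_cast hsq
    exact le_of_sq_le_sq h (by positivity)
  calc 2 * ((p : ℝ) + 1) ^ (p + 1) * 2 ^ (((p : ℝ) - 1) / 2)
      ≤ 2 ^ (1 : ℝ) * (2 ^ (((p : ℝ) + 1) / 2)) ^ (p + 1) * 2 ^ (((p : ℝ) - 1) / 2) := by
        rw [Real.rpow_one]
        gcongr
    _ = 2 ^ (1 + ((p : ℝ) + 1) / 2 * (p + 1) + ((p : ℝ) - 1) / 2) := by
        rw [← Real.rpow_natCast (2 ^ (((p : ℝ) + 1) / 2)), ← Real.rpow_mul (by norm_num),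
          Real.rpow_add two_pos, Real.rpow_add two_pos]
        push_cast
        rfl
    _ ≤ _ := by
        apply Real.rpow_le_rpow_of_exponent_le one_le_two
        nlinarith

/-- Lower bound for `A N` from a bound on the accumulated decrease. -/
theorem le_of_sum_decrease_le {p N : ℕ} (hp : 1 ≤ p) (hN : 1 ≤ N) {A a L r : ℕ → ℝ} {θ V : ℝ}
    (hA0 : A 0 = 0) (hA : ∀ k, A (k + 1) = A k + a (k + 1)) (ha : ∀ k, 0 < a (k + 1))
    (hL : ∀ k, 0 < L k) (hr : ∀ k, 0 < r k) (hθ : 0 < θ)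
    (hquad : ∀ k, a (k + 1) ^ 2 * L k = A (k + 1))
    (hstep : ∀ k, θ * L k ≤ r k ^ (p - 1))
    (hV : ∑ k ∈ range N, A (k + 1) * L k * r k ^ 2 ≤ V) :
    θ * (N : ℝ) ^ ((3 * (p : ℝ) + 1) / 2) ≤
      A N * ((p : ℝ) + 1) ^ (p + 1) * V ^ (((p : ℝ) - 1) / 2) := by
  have hp1 : (1 : ℝ) ≤ p := by exact_mod_cast hp
  have hN0 : (0 : ℝ) < N := by exact_mod_cast hN
  have hAnn : ∀ k, 0 ≤ A k := by
    intro k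
    induction k with
    | zero => exact hA0.ge
    | succ k ih => rw [hA]; exact add_nonneg ih (ha k).le
  have hApos : ∀ k, 0 < A (k + 1) := fun k => by
    rw [hA]; exact add_pos_of_nonneg_of_pos (hAnn k) (ha k)
  have hv : ∀ k, 0 < A (k + 1) * L k * r k ^ 2 := fun k =>
    mul_pos (mul_pos (hApos k) (hL k)) (pow_pos (hr k) 2)
  have hV0 : 0 < V :=
    (sum_pos (fun k _ => hv k) (nonempty_range_iff.2 (by omega))).trans_le hV
  set η : ℝ := 1 / ((p : ℝ) + 1) with hη
  set σ : ℝ := ((p : ℝ) - 1) / (2 * (p + 1)) with hσ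
  have hσ0 : 0 ≤ σ := div_nonneg (by linarith) (by positivity)
  have htel : ∀ K, ∑ k ∈ range K, η * θ ^ η * (A (k + 1) * L k * r k ^ 2) ^ (-σ) ≤ A K ^ η := by
    intro K
    induction K with
    | zero => simpa using Real.rpow_nonneg (hAnn 0) η
    | succ K ih =>
      rw [sum_range_succ]
      have := rpow_add_le_rpow_of_step hp (hAnn K) (ha K) (hL K) (hr K) hθ (hA K) (hquad K)
        (hstep K)
      linarith
  have hlow : η * θ ^ η * (N * (V / N) ^ (-σ)) ≤ A N ^ η := by
    refine le_trans ?_ (htel N)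
    rw [← mul_sum]
    have := card_mul_rpow_neg_le_sum_rpow_neg hN hv hσ0 hV
    gcongr
  have hpow := pow_le_pow_left₀ (by positivity) hlow (p + 1)
  have hroot : ∀ b : ℝ, 0 ≤ b → (b ^ η) ^ (p + 1) = b := by
    intro b hb
    rw [hη, ← Real.rpow_natCast, ← Real.rpow_mul hb]
    push_cast
    rw [one_div_mul_cancel (by positivity), Real.rpow_one]
  have hσp : ((V / N) ^ (-σ)) ^ (p + 1) = (V / N) ^ (-(((p : ℝ) - 1) / 2)) := by
    rw [← Real.rpow_natCast, ← Real.rpow_mul (by positivity), hσ]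
    congr 1
    push_cast
    field_simp
  rw [mul_pow, mul_pow, mul_pow, hroot _ hθ.le, hroot _ (hAnn N), hσp,
    Real.rpow_neg (by positivity), Real.div_rpow hV0.le hN0.le, hη, one_div, inv_pow, inv_div] at hpow
  have hNexp : (N : ℝ) ^ ((3 * (p : ℝ) + 1) / 2) =
      (N : ℝ) ^ (p + 1) * (N : ℝ) ^ (((p : ℝ) - 1) / 2) := by
    rw [← Real.rpow_natCast, ← Real.rpow_add hN0]
    congr 1
    push_cast
    ring
  rw [hNexp]
  have hVp : 0 < V ^ (((p : ℝ) - 1) / 2) := by positivity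
  have hm : (0 : ℝ) < ((p : ℝ) + 1) ^ (p + 1) := by positivity
  calc θ * ((N : ℝ) ^ (p + 1) * (N : ℝ) ^ (((p : ℝ) - 1) / 2))
      = ((((p : ℝ) + 1) ^ (p + 1))⁻¹ * θ * ((N : ℝ) ^ (p + 1) *
        ((N : ℝ) ^ (((p : ℝ) - 1) / 2) / V ^ (((p : ℝ) - 1) / 2)))) *
        (((p : ℝ) + 1) ^ (p + 1) * V ^ (((p : ℝ) - 1) / 2)) := by field_simp
    _ ≤ A N * (((p : ℝ) + 1) ^ (p + 1) * V ^ (((p : ℝ) - 1) / 2)) := by gcongr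
    _ = _ := by ring

end Growth

/-- Theorem 1: convergence of the Optimal Tensor Method (Algorithm 1):
`f(y^N) - f(x_*) ≤ c M_p ‖y^0 - x_*‖^{p+1} / N^{(3p+1)/2}` with
`c = 2^{(3(p+1)²+4)/4} (p+1)/p!`. -/
theorem optimal_tensor_method_convergence {n : ℕ} (p : ℕ) (hp : 3 ≤ p)
    (Mp : ℝ) (hMp : 0 < Mp)
    (f : EuclideanSpace ℝ (Fin n) → ℝ)
    (hconv : ConvexOn ℝ Set.univ f)
    (hlip : HasLipschitzPthDeriv p Mp f)
    (xstar : EuclideanSpace ℝ (Fin n)) (hmin : ∀ z, f xstar ≤ f z)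
    (x y u : ℕ → EuclideanSpace ℝ (Fin n))
    (L a A : ℕ → ℝ) (hL : ∀ k, 0 < L k)
    (hA0 : A 0 = 0) (hu0 : u 0 = y 0)
    (ha : ∀ k, a (k + 1) = (1 / L k + Real.sqrt (1 / (L k) ^ 2 + 4 * A k / L k)) / 2)
    (hA : ∀ k, A (k + 1) = A k + a (k + 1))
    (hx : ∀ k, x k = (A k / A (k + 1)) • y k + (a (k + 1) / A (k + 1)) • u k)
    (hy : ∀ k, IsMinOn (fun z => taylorModel p f (x k) z
        + ((p : ℝ) * Mp / (Nat.factorial (p + 1) : ℝ)) * ‖z - x k‖ ^ (p + 1)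
        + (L k / 2) * ‖z - x k‖ ^ 2) Set.univ (y (k + 1)))
    (hstep : ∀ k,
        1 / 2 ≤ (2 * ((p : ℝ) + 1) * Mp / ((Nat.factorial p : ℝ) * L k))
            * ‖y (k + 1) - x k‖ ^ (p - 1) ∧
        (2 * ((p : ℝ) + 1) * Mp / ((Nat.factorial p : ℝ) * L k))
            * ‖y (k + 1) - x k‖ ^ (p - 1) ≤ 1)
    (hu : ∀ k, u (k + 1) = u k - a (k + 1) • gradient f (y (k + 1))) :
    ∀ N : ℕ, 1 ≤ N →
      f (y N) - f xstar ≤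
        (2 ^ ((3 * ((p : ℝ) + 1) ^ 2 + 4) / 4) * ((p : ℝ) + 1) / (Nat.factorial p : ℝ))
          * Mp * ‖y 0 - xstar‖ ^ (p + 1) / (N : ℝ) ^ ((3 * (p : ℝ) + 1) / 2) := by
  intro N hN
  have hp1 : 1 ≤ p := by omega
  have hp1' : (1 : ℝ) ≤ p := by exact_mod_cast hp1
  have hfact : (0 : ℝ) < p.factorial := by positivity
  have hdiff : Differentiable ℝ f := hlip.1.differentiable (by norm_cast; omega)
  have hanext : ∀ k, 0 ≤ A k → 0 < a (k + 1) ∧ a (k + 1) ^ 2 * L k = A (k + 1) := by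
    intro k hk
    have hLk := hL k
    have hdisc : 0 ≤ 1 / (L k) ^ 2 + 4 * A k / L k := by positivity
    refine ⟨by rw [ha]; positivity, ?_⟩
    rw [hA, ha]
    have hs := Real.sq_sqrt hdisc
    set s := Real.sqrt (1 / (L k) ^ 2 + 4 * A k / L k)
    have hs' : s ^ 2 * L k ^ 2 = 1 + 4 * A k * L k := by
      rw [hs]; field_simp
    field_simp
    linear_combination hs'
  have hAnn : ∀ k, 0 ≤ A k := by
    intro k
    induction k with
    | zero => exact hA0.ge
    | succ k ih => rw [hA]; exact add_nonneg ih (hanext k ih).1.le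
  have hapos : ∀ k, 0 < a (k + 1) := fun k => (hanext k (hAnn k)).1
  have hquad : ∀ k, a (k + 1) ^ 2 * L k = A (k + 1) := fun k => (hanext k (hAnn k)).2
  have hApos : ∀ k, 0 < A (k + 1) := fun k => by
    rw [hA]; exact add_pos_of_nonneg_of_pos (hAnn k) (hapos k)
  set r : ℕ → ℝ := fun k => ‖y (k + 1) - x k‖ with hr
  have hrpos : ∀ k, 0 < r k := by
    intro k
    refine (norm_nonneg _).lt_of_ne fun h => ?_
    have h1 := (hstep k).1
    rw [← h, zero_pow (by omega)] at h1
    norm_num at h1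
  set θ : ℝ := p.factorial / (4 * (p + 1) * Mp) with hθdef
  have hθ : 0 < θ := by positivity
  have hθstep : ∀ k, θ * L k ≤ r k ^ (p - 1) := by
    intro k
    have hLk := hL k
    have h1 := (hstep k).1
    rw [div_mul_eq_mul_div, le_div_iff₀ (by positivity)] at h1
    rw [hθdef, div_mul_eq_mul_div, div_le_iff₀ (by positivity)]
    linarith
  have hdec : ∀ k, A (k + 1) * (f (y (k + 1)) - f xstar) + ‖u (k + 1) - xstar‖ ^ 2 / 2
      + 3 / 8 * (A (k + 1) * L k * r k ^ 2) ≤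
      A k * (f (y k) - f xstar) + ‖u k - xstar‖ ^ 2 / 2 := by
    intro k
    refine potential_decrease (hAnn k) (hapos k).le (hApos k) (hA k) (hquad k) (hx k) (hu k)
      (hconv.add_inner_gradient_le (hdiff _) _) (hconv.add_inner_gradient_le (hdiff _) _) ?_
    refine (norm_gradient_add_smul_le hp1 hMp hlip (hy k)).trans ?_
    have hLk := hL k
    have h2 := (hstep k).2
    rw [div_mul_eq_mul_div, div_le_one (by positivity)] at h2
    have h3 : ((p : ℝ) + 1) * Mp / p.factorial * ‖y (k + 1) - x k‖ ^ (p - 1) ≤ L k / 2 := by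
      rw [div_mul_eq_mul_div, div_le_iff₀ hfact]
      linarith
    obtain ⟨q, rfl⟩ : ∃ q, p = q + 1 := ⟨p - 1, by omega⟩
    rw [pow_succ, ← mul_assoc]
    exact mul_le_mul_of_nonneg_right h3 (norm_nonneg _)
  set R : ℝ := ‖y 0 - xstar‖ with hR
  have hpot : ∀ K, A K * (f (y K) - f xstar) + ‖u K - xstar‖ ^ 2 / 2
      + 3 / 8 * ∑ k ∈ Finset.range K, A (k + 1) * L k * r k ^ 2 ≤ R ^ 2 / 2 := by
    intro K
    induction K with
    | zero => simp [hA0, hu0, hR]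
    | succ K ih =>
      rw [Finset.sum_range_succ]
      linarith [hdec K]
  have hgap : 0 ≤ f (y N) - f xstar := sub_nonneg.2 (hmin _)
  have hSnn : 0 ≤ ∑ k ∈ Finset.range N, A (k + 1) * L k * r k ^ 2 :=
    Finset.sum_nonneg fun k _ => by have := hApos k; have := hL k; positivity
  have hV : ∑ k ∈ Finset.range N, A (k + 1) * L k * r k ^ 2 ≤ 2 * R ^ 2 := by
    have := hpot N
    have := mul_nonneg (hAnn N) hgap
    nlinarith [sq_nonneg ‖u N - xstar‖]
  have hgrowth := le_of_sum_decrease_le hp1 hN hA0 hA hapos hL hrpos hθ hquad hθstep hV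
  have hAgap : A N * (f (y N) - f xstar) ≤ R ^ 2 / 2 := by
    have := hpot N
    nlinarith [sq_nonneg ‖u N - xstar‖]
  have hRpow : (2 * R ^ 2) ^ (((p : ℝ) - 1) / 2) = 2 ^ (((p : ℝ) - 1) / 2) * R ^ (p - 1) := by
    rw [Real.mul_rpow zero_le_two (sq_nonneg R), ← Real.rpow_natCast R 2,
      ← Real.rpow_mul (norm_nonneg _), ← Real.rpow_natCast R (p - 1), Nat.cast_sub hp1]
    congr 2
    push_cast
    ring
  have hN0 : (0 : ℝ) < N := by exact_mod_cast hN
  rw [le_div_iff₀ (by positivity)]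
  have hfinal : θ * ((f (y N) - f xstar) * (N : ℝ) ^ ((3 * (p : ℝ) + 1) / 2)) ≤
      θ * (4 * (p + 1) * Mp / p.factorial * ((p + 1) ^ (p + 1) * 2 ^ (((p : ℝ) - 1) / 2) / 2)
        * R ^ (p + 1)) := by
    have hθinv : θ * (4 * (p + 1) * Mp / p.factorial) = 1 := by
      rw [hθdef]; field_simp
    calc θ * ((f (y N) - f xstar) * (N : ℝ) ^ ((3 * (p : ℝ) + 1) / 2))
        = (f (y N) - f xstar) * (θ * (N : ℝ) ^ ((3 * (p : ℝ) + 1) / 2)) := by ring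
      _ ≤ (f (y N) - f xstar) *
          (A N * ((p : ℝ) + 1) ^ (p + 1) * (2 * R ^ 2) ^ (((p : ℝ) - 1) / 2)) := by gcongr
      _ = (A N * (f (y N) - f xstar)) *
          (((p : ℝ) + 1) ^ (p + 1) * 2 ^ (((p : ℝ) - 1) / 2) * R ^ (p - 1)) := by
          rw [hRpow]; ring
      _ ≤ R ^ 2 / 2 * (((p : ℝ) + 1) ^ (p + 1) * 2 ^ (((p : ℝ) - 1) / 2) * R ^ (p - 1)) := by
          gcongr
      _ = ((p + 1) ^ (p + 1) * 2 ^ (((p : ℝ) - 1) / 2) / 2) * R ^ (p + 1) := by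
          rw [show p + 1 = 2 + (p - 1) by omega, pow_add R]; ring
      _ = (θ * (4 * (p + 1) * Mp / p.factorial)) *
          (((p + 1) ^ (p + 1) * 2 ^ (((p : ℝ) - 1) / 2) / 2) * R ^ (p + 1)) := by
          rw [hθinv, one_mul]
      _ = _ := by ring
  refine (le_of_mul_le_mul_left hfinal hθ).trans ?_
  calc 4 * (p + 1) * Mp / p.factorial * ((p + 1) ^ (p + 1) * 2 ^ (((p : ℝ) - 1) / 2) / 2)
        * R ^ (p + 1)
      = 2 * ((p : ℝ) + 1) ^ (p + 1) * 2 ^ (((p : ℝ) - 1) / 2) *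
        ((p + 1) / p.factorial * Mp * R ^ (p + 1)) := by ring
    _ ≤ 2 ^ ((3 * ((p : ℝ) + 1) ^ 2 + 4) / 4) * ((p + 1) / p.factorial * Mp * R ^ (p + 1)) := by
        have := two_mul_rpow_le_two_rpow hp
        gcongr
    _ = _ := by ring
end

section
/- Let p ≥ 1 be an integer, M_p > 0, and let f : ℝ^n → ℝ be convex with M_p-Lipschitz p-th derivative. Then for every x ∈ ℝ^n and every M ≥ p M_p, the function y ↦ Ω_p(f, x; y) + (M/(p+1)!) ∥y − x∥^{p+1} is convex on ℝ^n. -/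
section Line

variable {E F : Type*} [NormedAddCommGroup E] [NormedSpace ℝ E]
  [NormedAddCommGroup F] [NormedSpace ℝ F]

theorem hasDerivAt_add_smul_const (a h : E) (t : ℝ) :
    HasDerivAt (fun t : ℝ => a + t • h) h t := by
  simpa using ((hasDerivAt_id t).smul_const h).const_add a

theorem convexOn_univ_of_forall_line {f : E → ℝ}
    (hf : ∀ a h : E, ConvexOn ℝ Set.univ fun t : ℝ => f (a + t • h)) :
    ConvexOn ℝ Set.univ f := by
  refine ⟨convex_univ, fun y _ z _ a b ha hb hab => ?_⟩
  have key := (hf y (z - y)).2 (Set.mem_univ 0) (Set.mem_univ 1) ha hb hab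
  have hy : a • y + b • z = y + b • (z - y) := by
    rw [← eq_sub_iff_add_eq] at hab
    rw [hab]
    module
  simpa [hy] using key

theorem ConvexOn.comp_add_smul {f : E → ℝ} (hf : ConvexOn ℝ Set.univ f) (a h : E) :
    ConvexOn ℝ Set.univ fun t : ℝ => f (a + t • h) := by
  refine ⟨convex_univ, fun s _ t _ b c hb hc hbc => ?_⟩
  have key := hf.2 (Set.mem_univ (a + s • h)) (Set.mem_univ (a + t • h)) hb hc hbc
  have hy : a + (b • s + c • t) • h = b • (a + s • h) + c • (a + t • h) := by
    rw [← eq_sub_iff_add_eq] at hbc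
    rw [hbc]
    simp only [smul_eq_mul]
    module
  simpa only [hy] using key

theorem ContDiff.hasDerivAt_iteratedFDeriv_add_smul {n : ℕ∞} {f : E → F} (hf : ContDiff ℝ n f)
    {r : ℕ} (hr : r < n) (a h : E) (v : Fin r → E) (t : ℝ) :
    HasDerivAt (fun t : ℝ => iteratedFDeriv ℝ r f (a + t • h) v)
      (iteratedFDeriv ℝ (r + 1) f (a + t • h) (Fin.cons h v : Fin (r + 1) → E)) t := by
  have hd := (hf.differentiable_iteratedFDeriv (m := r) (mod_cast hr) (a + t • h)).hasFDerivAt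
  exact (hd.continuousMultilinear_apply_const v).comp_hasDerivAt t
    (hasDerivAt_add_smul_const a h t)

/-- The iterated derivatives of a `C^n` function, up to order `n`, are symmetric. -/
theorem ContDiff.iteratedFDeriv_comp_perm {n : ℕ∞} {f : E → F} (hf : ContDiff ℝ n f)
    {r : ℕ} (hr : r ≤ n) (x : E) (v : Fin r → E) (σ : Equiv.Perm (Fin r)) :
    iteratedFDeriv ℝ r f x (v ∘ σ) = iteratedFDeriv ℝ r f x v := by
  induction r generalizing x with
  | zero => rw [Subsingleton.elim (v ∘ σ) v]
  | succ r ih =>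
    cases r with
    | zero => rw [Subsingleton.elim (α := Equiv.Perm (Fin 1)) σ 1]; rfl
    | succ r =>
      have hlt : ((r + 1 : ℕ) : ℕ∞) < n := lt_of_lt_of_le (mod_cast Nat.lt_succ_self _) hr
      have hlt' : ((r : ℕ) : ℕ∞) < n := lt_of_lt_of_le (mod_cast (by omega)) hr
      have happ (u : Fin (r + 2) → E) : iteratedFDeriv ℝ (r + 2) f x u =
          fderiv ℝ (fun y => iteratedFDeriv ℝ (r + 1) f y (Fin.tail u)) x (u 0) :=
        (hf.differentiable_iteratedFDeriv (m := r + 1) (mod_cast hlt)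
          x).iteratedFDeriv_succ_apply_left'
      have hσ : σ ∈ Submonoid.closure
          (Set.range fun i : Fin (r + 1) => Equiv.swap i.castSucc i.succ) := by
        rw [Equiv.Perm.mclosure_swap_castSucc_succ]; trivial
      induction hσ using Submonoid.closure_induction generalizing v with
      | one => rfl
      | mul σ τ _ _ hσ hτ =>
        rw [Equiv.Perm.coe_mul, ← Function.comp_assoc, hτ, hσ]
      | mem σ hσ =>
        obtain ⟨i, rfl⟩ := hσ
        cases i using Fin.cases with
        | zero =>
          set u : Fin r → E := Fin.tail (Fin.tail v)
          let g : E → F := fun y => iteratedFDeriv ℝ r f y u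
          have hg : ContDiff ℝ 2 g := by
            have : ContDiff ℝ 2 (iteratedFDeriv ℝ r f) :=
              hf.iteratedFDeriv_right (by
                have h2 : ((2 + r : ℕ) : ℕ∞) ≤ n := by rw [add_comm]; exact hr
                simpa using WithTop.coe_le_coe.2 h2)
            exact (ContinuousMultilinearMap.apply ℝ (fun _ : Fin r => E) F u).contDiff.comp this
          have hfst (y b : E) : iteratedFDeriv ℝ (r + 1) f y (Fin.cons b u : Fin (r + 1) → E) =
              fderiv ℝ g y b := by
            rw [(hf.differentiable_iteratedFDeriv (m := r) (mod_cast hlt')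
              y).iteratedFDeriv_succ_apply_left']
            simp [g]
          have hdd : DifferentiableAt ℝ (fderiv ℝ g) x :=
            (hg.fderiv_right (m := 1) (by norm_num)).differentiable one_ne_zero x
          have hsnd (a b : E) : iteratedFDeriv ℝ (r + 2) f x
              (Fin.cons a (Fin.cons b u : Fin (r + 1) → E) : Fin (r + 2) → E) =
              fderiv ℝ (fderiv ℝ g) x a b := by
            rw [happ]
            simp only [Fin.tail_cons, Fin.cons_zero, hfst]
            rw [fderiv_clm_apply hdd (differentiableAt_const b)]
            simp
          have hv : v = Fin.cons (v 0) (Fin.cons (v 1) u : Fin (r + 1) → E) := by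
            ext i
            refine Fin.cases rfl (fun i => Fin.cases rfl (fun i => rfl) i) i
          have hv' : v ∘ Equiv.swap (Fin.castSucc 0) (Fin.succ 0) =
              Fin.cons (v 1) (Fin.cons (v 0) u : Fin (r + 1) → E) := by
            ext i
            refine Fin.cases (by simp) (fun i => Fin.cases (by simp) (fun i => ?_) i) i
            have h0 : i.succ.succ ≠ Fin.castSucc (0 : Fin (r + 1)) := by
              simp [Fin.ext_iff]
            have h1 : i.succ.succ ≠ Fin.succ (0 : Fin (r + 1)) := by
              simp [Fin.ext_iff]
            simp only [Function.comp, Equiv.swap_apply_of_ne_of_ne h0 h1]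
            rfl
          rw [hv', hsnd]
          conv_rhs => rw [hv, hsnd]
          exact (hg.contDiffAt.isSymmSndFDerivAt (by simp)) _ _
        | succ j =>
          have h0 : (v ∘ Equiv.swap j.succ.castSucc j.succ.succ) 0 = v 0 := by
            have h0 : (0 : Fin (r + 2)) ≠ j.succ.castSucc := by simp [Fin.ext_iff]
            have h1 : (0 : Fin (r + 2)) ≠ j.succ.succ := by simp [Fin.ext_iff]
            simp only [Function.comp, Equiv.swap_apply_of_ne_of_ne h0 h1]
          have ht : Fin.tail (v ∘ Equiv.swap j.succ.castSucc j.succ.succ) =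
              Fin.tail v ∘ Equiv.swap j.castSucc j.succ := by
            ext i
            simp only [Fin.tail, Function.comp]
            rw [← Fin.succ_castSucc, ← (Fin.succ_injective _).swap_apply]
          rw [happ, happ, h0, ht]
          simp only [ih hlt.le]

/-- The derivative of a symmetric multilinear form on the diagonal, along a line. -/
theorem ContinuousMultilinearMap.hasDerivAt_diagonal_of_symm {r : ℕ}
    (A : ContinuousMultilinearMap ℝ (fun _ : Fin (r + 1) => E) F)
    (hA : ∀ (v : Fin (r + 1) → E) (σ : Equiv.Perm (Fin (r + 1))), A (v ∘ σ) = A v)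
    (a h : E) (t : ℝ) :
    HasDerivAt (fun t : ℝ => A fun _ => a + t • h)
      ((r + 1 : ℝ) • A.curryLeft h fun _ => a + t • h) t := by
  have hw : HasDerivAt (fun (t : ℝ) (_ : Fin (r + 1)) => a + t • h) (fun _ => h) t :=
    hasDerivAt_pi.2 fun _ => hasDerivAt_add_smul_const a h t
  refine ((A.hasFDerivAt (fun _ => a + t • h)).comp_hasDerivAt t hw).congr_deriv ?_
  rw [ContinuousMultilinearMap.linearDeriv_apply]
  have hi (i : Fin (r + 1)) : A (Function.update (fun _ => a + t • h) i h) =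
      A.curryLeft h fun _ => a + t • h := by
    rw [ContinuousMultilinearMap.curryLeft_apply, ← hA _ (Equiv.swap 0 i)]
    congr 1
    ext j
    refine Fin.cases (by simp) (fun j => ?_) j
    have hj : Equiv.swap 0 i j.succ ≠ i := fun hj => Fin.succ_ne_zero j (by
      rwa [Equiv.swap_apply_eq_iff, Equiv.swap_apply_right] at hj)
    simp [Function.update_of_ne hj]
  simp only [hi, Finset.sum_const, Finset.card_univ, Fintype.card_fin]
  rw [← Nat.cast_smul_eq_nsmul ℝ]
  push_cast
  rfl

theorem hasDerivAt_sum_diagonal_of_symm {N : ℕ}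
    (A : ∀ r, ContinuousMultilinearMap ℝ (fun _ : Fin r => E) ℝ)
    (hA : ∀ r ≤ N, ∀ (v : Fin r → E) (σ : Equiv.Perm (Fin r)), A r (v ∘ σ) = A r v)
    (a h : E) (t : ℝ) :
    HasDerivAt
      (fun t : ℝ => ∑ r ∈ Finset.range (N + 1), (1 / (r.factorial : ℝ)) * A r fun _ => a + t • h)
      (∑ r ∈ Finset.range N,
        (1 / (r.factorial : ℝ)) * (A (r + 1)).curryLeft h fun _ => a + t • h) t := by
  simp only [Finset.sum_range_succ' _ N]
  have hc : HasDerivAt (fun t : ℝ => (1 / (Nat.factorial 0 : ℝ)) * A 0 fun _ => a + t • h) 0 t := by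
    have : (fun t : ℝ => (1 / (Nat.factorial 0 : ℝ)) * A 0 fun _ => a + t • h) =
        fun _ => (1 / (Nat.factorial 0 : ℝ)) * A 0 0 := by
      funext t
      rw [Subsingleton.elim (fun _ : Fin 0 => a + t • h) 0]
    rw [this]
    exact hasDerivAt_const _ _
  refine ((HasDerivAt.fun_sum fun r hr => ?_).add hc).congr_deriv (add_zero _)
  have hr' : r + 1 ≤ N := Finset.mem_range.1 hr
  refine (((A (r + 1)).hasDerivAt_diagonal_of_symm (hA _ hr') a h t).const_mul _).congr_deriv ?_
  rw [Nat.factorial_succ, smul_eq_mul]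
  have : (r.factorial : ℝ) ≠ 0 := mod_cast r.factorial_ne_zero
  push_cast
  field_simp

theorem ContinuousMultilinearMap.curryLeft_comp_perm {r : ℕ}
    (A : ContinuousMultilinearMap ℝ (fun _ : Fin (r + 1) => E) F)
    (hA : ∀ (v : Fin (r + 1) → E) (σ : Equiv.Perm (Fin (r + 1))), A (v ∘ σ) = A v)
    (h : E) (v : Fin r → E) (σ : Equiv.Perm (Fin r)) :
    A.curryLeft h (v ∘ σ) = A.curryLeft h v := by
  rw [curryLeft_apply, curryLeft_apply]
  refine Eq.trans ?_ (hA _ (Equiv.Perm.decomposeFin.symm (0, σ)))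
  congr 1
  ext i
  refine Fin.cases (by simp) (fun i => by simp) i

end Line

/-- Upper Taylor bound for a function whose last derivative grows at most linearly. -/
theorem le_taylor_add_of_le {m : ℕ} {φ : ℕ → ℝ → ℝ} {C : ℝ}
    (hd : ∀ k < m, ∀ s, HasDerivAt (φ k) (φ (k + 1) s) s)
    (hC : ∀ s, 0 ≤ s → φ m s ≤ φ m 0 + C * s) {s : ℝ} (hs : 0 ≤ s) :
    φ 0 s ≤ ∑ k ∈ Finset.range (m + 1), (1 / (k.factorial : ℝ)) * φ k 0 * s ^ k
      + C * s ^ (m + 1) / ((m + 1).factorial : ℝ) := by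
  induction m generalizing φ s with
  | zero => simpa using hC s hs
  | succ m ih =>
    have ih' := fun s (hs : 0 ≤ s) => ih (φ := fun k => φ (k + 1))
      (fun k hk => hd (k + 1) (by omega)) hC hs
    let P : ℝ → ℝ := fun s =>
      ∑ k ∈ Finset.range (m + 1 + 1), (1 / (k.factorial : ℝ)) * φ k 0 * s ^ k
      + C * s ^ (m + 1 + 1) / ((m + 1 + 1).factorial : ℝ) - φ 0 s
    have hP (s : ℝ) : HasDerivAt P
        (∑ k ∈ Finset.range (m + 1), (1 / (k.factorial : ℝ)) * φ (k + 1) 0 * s ^ k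
          + C * s ^ (m + 1) / ((m + 1).factorial : ℝ) - φ 1 s) s := by
      refine HasDerivAt.sub (HasDerivAt.add ?_ ?_) (hd 0 (by omega) s)
      · simp only [Finset.sum_range_succ' _ (m + 1), pow_zero]
        refine ((HasDerivAt.fun_sum fun k _ => ?_).add (hasDerivAt_const s _)).congr_deriv
          (add_zero _)
        refine ((hasDerivAt_pow (k + 1) s).const_mul _).congr_deriv ?_
        have : (k.factorial : ℝ) ≠ 0 := mod_cast k.factorial_ne_zero
        rw [Nat.factorial_succ]
        push_cast
        field_simp
      · refine (((hasDerivAt_pow (m + 1 + 1) s).const_mul C).div_const _).congr_deriv ?_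
        have : ((m + 1).factorial : ℝ) ≠ 0 := mod_cast (m + 1).factorial_ne_zero
        rw [Nat.factorial_succ (m + 1)]
        push_cast
        field_simp
    have hmono : MonotoneOn P (Set.Ici 0) := by
      refine monotoneOn_of_hasDerivWithinAt_nonneg (convex_Ici 0)
        (fun s _ => (hP s).continuousAt.continuousWithinAt)
        (fun s _ => (hP s).hasDerivWithinAt) fun s hs => ?_
      rw [interior_Ici] at hs
      exact sub_nonneg.2 (ih' s (le_of_lt hs))
    have h0 : P 0 = 0 := by
      simp [P, Finset.sum_range_succ' _ (m + 1)]
    have := hmono Set.self_mem_Ici hs hs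
    rw [h0] at this
    exact sub_nonneg.1 this

theorem ConvexOn.iteratedFDeriv_two_nonneg {E : Type*} [NormedAddCommGroup E] [NormedSpace ℝ E]
    {f : E → ℝ} (hf : ConvexOn ℝ Set.univ f) (hf2 : ContDiff ℝ 2 f) (y h : E) :
    0 ≤ iteratedFDeriv ℝ 2 f y fun _ => h := by
  have hf2' : ContDiff ℝ (2 : ℕ∞) f := hf2
  have h1 (t : ℝ) : HasDerivAt (fun t : ℝ => f (y + t • h))
      (iteratedFDeriv ℝ 1 f (y + t • h) fun _ => h) t := by
    refine (hf2'.hasDerivAt_iteratedFDeriv_add_smul (r := 0) (by norm_num)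
      y h (fun _ => h) t).congr_deriv ?_
    congr 1
    ext i
    refine Fin.cases rfl (fun i => rfl) i
  have h2 : HasDerivAt (fun t : ℝ => iteratedFDeriv ℝ 1 f (y + t • h) fun _ => h)
      (iteratedFDeriv ℝ 2 f (y + (0 : ℝ) • h) fun _ => h) 0 := by
    refine (hf2'.hasDerivAt_iteratedFDeriv_add_smul (r := 1) (by norm_num)
      y h (fun _ => h) 0).congr_deriv ?_
    congr 1
    ext i
    refine Fin.cases rfl (fun i => rfl) i
  have hmono := (hf.comp_add_smul y h).monotoneOn_deriv fun t _ => (h1 t).differentiableAt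
  rw [monotoneOn_univ, funext fun t => (h1 t).deriv] at hmono
  simpa using h2.nonneg_of_monotone hmono

section Norm

variable {E : Type*} [NormedAddCommGroup E] [InnerProductSpace ℝ E]

theorem hasDerivAt_norm_add_smul_pow (m : ℕ) (a h : E) (t : ℝ) :
    HasDerivAt (fun t : ℝ => ‖a + t • h‖ ^ (m + 2))
      ((m + 2) * (‖a + t • h‖ ^ m * inner ℝ (a + t • h) h)) t := by
  have hp : (1 : ℝ) < ((m + 2 : ℕ) : ℝ) := by exact_mod_cast (by omega : 1 < m + 2)
  have := (hasFDerivAt_norm_rpow (a + t • h) hp).comp_hasDerivAt t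
    (hasDerivAt_add_smul_const a h t)
  have he : ((m + 2 : ℕ) : ℝ) - 2 = m := by push_cast; ring
  simp only [he, Real.rpow_natCast, Function.comp_def] at this
  refine this.congr_deriv ?_
  simp [inner_add_left, real_inner_smul_left]
  ring

theorem exists_hasDerivAt_norm_pow_mul_inner_ge (m : ℕ) (a h : E) (t : ℝ) :
    ∃ d, HasDerivAt (fun t : ℝ => ‖a + t • h‖ ^ (m + 1) * inner ℝ (a + t • h) h) d t ∧
      ‖a + t • h‖ ^ (m + 1) * ‖h‖ ^ 2 ≤ d := by
  have hw := hasDerivAt_add_smul_const a h t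
  have hi : HasDerivAt (fun t : ℝ => inner ℝ (a + t • h) h) (‖h‖ ^ 2) t := by
    simpa using hw.inner ℝ (hasDerivAt_const t h)
  by_cases h0 : a + t • h = 0
  · refine ⟨0, ?_, by simp [h0]⟩
    have hc : Filter.Tendsto (fun t : ℝ => ‖a + t • h‖ ^ (m + 1)) (nhds t) (nhds 0) := by
      have : ContinuousAt (fun t : ℝ => ‖a + t • h‖ ^ (m + 1)) t := by fun_prop
      simpa [ContinuousAt, h0] using this
    have hO := hi.differentiableAt.isBigO_sub
    have := ((Asymptotics.isLittleO_one_iff ℝ).2 hc).mul_isBigO hO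
    refine HasDerivAt.of_isLittleO ?_
    simpa [h0] using this
  · have hpos : 0 < ‖a + t • h‖ := norm_pos_iff.2 h0
    have hn : HasDerivAt (fun t : ℝ => ‖a + t • h‖) (inner ℝ (a + t • h) h / ‖a + t • h‖) t := by
      have := hw.norm_sq.sqrt (by positivity)
      simp only [Real.sqrt_sq (norm_nonneg _)] at this
      refine this.congr_deriv ?_
      field_simp
    refine ⟨_, (hn.pow (m + 1)).mul hi, ?_⟩
    have : 0 ≤ ((m + 1 : ℕ) : ℝ) * ‖a + t • h‖ ^ (m + 1 - 1) *
        (inner ℝ (a + t • h) h / ‖a + t • h‖) * inner ℝ (a + t • h) h := by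
      rw [mul_assoc, div_mul_eq_mul_div, ← sq]
      positivity
    simpa using this

end Norm

/-- The second derivative of the Taylor model in the direction `h`, corrected by the Lipschitz
bound on the remainder, dominates that of `f`, hence is nonnegative when `f` is convex. -/
theorem taylor_second_derivative_add_nonneg {E : Type*} [NormedAddCommGroup E] [NormedSpace ℝ E]
    {m : ℕ} {L : ℝ} {f : E → ℝ} (hconv : ConvexOn ℝ Set.univ f)
    (hf : ContDiff ℝ ((m + 2 : ℕ) : ℕ∞) f)
    (hL : ∀ x y, ‖iteratedFDeriv ℝ (m + 2) f x - iteratedFDeriv ℝ (m + 2) f y‖ ≤ L * ‖x - y‖)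
    (x w h : E) :
    0 ≤ ∑ r ∈ Finset.range (m + 1), (1 / (r.factorial : ℝ)) *
        ((iteratedFDeriv ℝ (r + 2) f x).curryLeft h).curryLeft h (fun _ => w)
      + L * ‖w‖ ^ (m + 1) * ‖h‖ ^ 2 / ((m + 1).factorial : ℝ) := by
  let v : ∀ k : ℕ, Fin (k + 2) → E := fun k i => if (i : ℕ) < k then w else h
  have hv (k : ℕ) : (Fin.cons w (v k) : Fin (k + 3) → E) = v (k + 1) := by
    ext i
    refine Fin.cases (by simp [v]) (fun i => by simp [v]) i
  let φ : ℕ → ℝ → ℝ := fun k s => iteratedFDeriv ℝ (k + 2) f (x + s • w) (v k)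
  have hd : ∀ k < m, ∀ s, HasDerivAt (φ k) (φ (k + 1) s) s := fun k hk s =>
    (hf.hasDerivAt_iteratedFDeriv_add_smul (mod_cast (by omega)) x w (v k) s).congr_deriv
      (by rw [hv])
  have hprod : ∏ i, ‖v m i‖ = ‖w‖ ^ m * ‖h‖ ^ 2 := by
    rw [Fin.prod_univ_castSucc, Fin.prod_univ_castSucc]
    simp [v]
    ring
  have hC (s : ℝ) (hs : 0 ≤ s) : φ m s ≤ φ m 0 + (L * ‖w‖ ^ (m + 1) * ‖h‖ ^ 2) * s := by
    have h1 := (iteratedFDeriv ℝ (m + 2) f (x + s • w)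
      - iteratedFDeriv ℝ (m + 2) f (x + (0 : ℝ) • w)).le_of_opNorm_le (hL _ _) (v m)
    rw [hprod] at h1
    have h2 := (le_abs_self _).trans h1
    simp only [sub_apply, zero_smul, add_zero, add_sub_cancel_left,
      norm_smul, Real.norm_eq_abs, abs_of_nonneg hs] at h2
    have h3 : φ m s - φ m 0 ≤ L * (s * ‖w‖) * (‖w‖ ^ m * ‖h‖ ^ 2) := by
      simpa [φ] using h2
    linarith [h3, (by ring : L * (s * ‖w‖) * (‖w‖ ^ m * ‖h‖ ^ 2) =
      (L * ‖w‖ ^ (m + 1) * ‖h‖ ^ 2) * s)]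
  have key := le_taylor_add_of_le hd hC zero_le_one
  have h0 : 0 ≤ φ 0 1 := by
    have : v 0 = fun _ => h := by ext i; simp [v]
    simp only [φ, this]
    exact hconv.iteratedFDeriv_two_nonneg
      (hf.of_le (by exact_mod_cast WithTop.coe_le_coe.2 (Nat.cast_le.2 (by omega : 2 ≤ m + 2)))) _ h
  refine h0.trans (key.trans_eq ?_)
  simp only [one_pow, mul_one]
  congr 1
  refine Finset.sum_congr rfl fun r hr => ?_
  have hr' : r < m + 1 := Finset.mem_range.1 hr
  congr 1
  simp only [φ, zero_smul, add_zero, ContinuousMultilinearMap.curryLeft_apply]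
  rw [← hf.iteratedFDeriv_comp_perm (mod_cast (by omega)) x (v r) Fin.revPerm]
  congr 1
  ext i
  refine Fin.cases (by simp [v]) (fun i => Fin.cases (by simp [v]) (fun i => ?_) i) i
  have hi := i.isLt
  simp only [v, Function.comp, Fin.revPerm_apply, Fin.val_rev, Fin.val_succ, Fin.cons_succ]
  rw [if_pos (by omega)]

theorem taylorModel_one {n : ℕ} (f : EuclideanSpace ℝ (Fin n) → ℝ)
    (x y : EuclideanSpace ℝ (Fin n)) :
    taylorModel 1 f x y = f x + fderiv ℝ f x (y - x) := by
  simp [taylorModel, Finset.sum_range_succ]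

/-- If `f` is convex with `M_p`-Lipschitz `p`-th derivative, then for every `x` and
every `M ≥ p M_p` the regularized Taylor model
`y ↦ Ω_p(f, x; y) + (M/(p+1)!) ‖y - x‖^{p+1}` is convex on `ℝⁿ`. -/
theorem regularized_taylor_model_convex {n : ℕ} (p : ℕ) (hp : 1 ≤ p)
    (Mp : ℝ) (hMp : 0 < Mp)
    (f : EuclideanSpace ℝ (Fin n) → ℝ)
    (hconv : ConvexOn ℝ Set.univ f)
    (hlip : HasLipschitzPthDeriv p Mp f) :
    ∀ x : EuclideanSpace ℝ (Fin n), ∀ M : ℝ, (p : ℝ) * Mp ≤ M →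
      ConvexOn ℝ Set.univ (fun z => taylorModel p f x z
        + (M / (Nat.factorial (p + 1) : ℝ)) * ‖z - x‖ ^ (p + 1)) := by
  intro x M hM
  obtain ⟨hf, hL⟩ := hlip
  have hM0 : 0 ≤ M := le_trans (by positivity) hM
  obtain rfl | ⟨m, rfl⟩ : p = 1 ∨ ∃ m, p = m + 2 := by
    rcases hp.eq_or_lt with h | h
    · exact Or.inl h.symm
    · exact Or.inr (Nat.exists_eq_add_of_le' h)
  · simp only [taylorModel_one]
    have hlin : ConvexOn ℝ Set.univ fun z => fderiv ℝ f x (z - x) := by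
      simpa [sub_eq_add_neg] using!
        ((fderiv ℝ f x).toLinearMap.convexOn convex_univ).add_const (fderiv ℝ f x (-x))
    have hnorm : ConvexOn ℝ Set.univ fun z : EuclideanSpace ℝ (Fin n) => ‖z - x‖ := by
      simpa [dist_eq_norm] using convexOn_univ_dist x
    simpa [add_comm] using! (hlin.add_const (f x)).add
      ((hnorm.pow (fun _ _ => norm_nonneg _) 2).smul (c := M / (Nat.factorial 2 : ℝ))
        (by positivity))
  · have hf' : ContDiff ℝ ((m + 2 : ℕ) : ℕ∞) f := hf
    refine convexOn_univ_of_forall_line fun a h => ?_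
    have hsymm : ∀ r ≤ m + 2, ∀ (v : Fin r → EuclideanSpace ℝ (Fin n)) (σ : Equiv.Perm (Fin r)),
        iteratedFDeriv ℝ r f x (v ∘ σ) = iteratedFDeriv ℝ r f x v := fun r hr =>
      hf'.iteratedFDeriv_comp_perm (mod_cast hr) x
    choose d hd hd_ge using exists_hasDerivAt_norm_pow_mul_inner_ge m (a - x) h
    set c : ℝ := M / ((m + 2 + 1).factorial : ℝ)
    have hsub (t : ℝ) : a + t • h - x = a - x + t • h := by abel
    simp only [taylorModel, hsub]
    have hd1 (t : ℝ) := (hasDerivAt_sum_diagonal_of_symm (fun r => iteratedFDeriv ℝ r f x)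
      hsymm (a - x) h t).add ((hasDerivAt_norm_add_smul_pow (m + 1) (a - x) h t).const_mul c)
    have hd2 (t : ℝ) := (hasDerivAt_sum_diagonal_of_symm (N := m + 1)
      (fun r => (iteratedFDeriv ℝ (r + 1) f x).curryLeft h)
      (fun r hr => ContinuousMultilinearMap.curryLeft_comp_perm _ (hsymm (r + 1) (by omega)) h)
      (a - x) h t).add (((hd t).const_mul ((m + 1 : ℕ) + 2 : ℝ)).const_mul c)
    refine convexOn_of_hasDerivWithinAt2_nonneg convex_univ
      (fun t _ => (hd1 t).continuousAt.continuousWithinAt)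
      (fun t _ => (hd1 t).hasDerivWithinAt) (fun t _ => (hd2 t).hasDerivWithinAt) fun t _ => ?_
    refine (taylor_second_derivative_add_nonneg hconv hf' hL x (a - x + t • h) h).trans ?_
    refine add_le_add le_rfl ?_
    set w := a - x + t • h
    have hc : c * ((m + 1 : ℕ) + 2) = M / ((m + 2).factorial : ℝ) := by
      have : ((m + 2).factorial : ℝ) ≠ 0 := mod_cast (m + 2).factorial_ne_zero
      simp only [c, Nat.factorial_succ (m + 2)]
      push_cast
      field_simp
      ring
    have hMp' : Mp / ((m + 1).factorial : ℝ) ≤ M / ((m + 2).factorial : ℝ) := by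
      rw [Nat.factorial_succ (m + 1), div_le_div_iff₀ (by positivity) (by positivity)]
      push_cast at hM ⊢
      have : (0 : ℝ) ≤ ((m + 1).factorial : ℝ) := by positivity
      nlinarith
    calc Mp * ‖w‖ ^ (m + 1) * ‖h‖ ^ 2 / ((m + 1).factorial : ℝ)
        = Mp / ((m + 1).factorial : ℝ) * (‖w‖ ^ (m + 1) * ‖h‖ ^ 2) := by ring
      _ ≤ M / ((m + 2).factorial : ℝ) * d t := by
          gcongr
          exact hd_ge t
      _ = c * (((m + 1 : ℕ) + 2) * d t) := by rw [← hc, mul_assoc]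
end
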